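/- Let k ≥ 1 and let K be the complete graph on the vertex set {(i,l) : 1 ≤ i,l ≤ k+1} (so K has (k+1)^2 vertices). Color an edge joining (i,l) and (j,m) with color 0 if i = j or l = m, and with color 1 otherwise. Then under this 2-edge-coloring, every two distinct vertices of K are joined by k pairwise internally vertex-disjoint rainbow paths. -/

import Mathlib

open SimpleGraph

namespace Paper

variable {V : Type*}

/-- The internal vertices of a walk (all vertices except the two endpoints). -/
def internalSupport {G : SimpleGraph V} {u v : V} (p : G.Walk u v) : List V :=
  p.support.tail.dropLast

/-- A family of walks between two fixed vertices is internally disjoint if the walks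
are pairwise distinct and no two of them share an internal vertex. -/
def InternallyDisjoint {G : SimpleGraph V} {u v : V} {k : ℕ}
    (P : Fin k → G.Walk u v) : Prop :=
  Function.Injective P ∧
    ∀ i j, i ≠ j → ∀ w, w ∈ internalSupport (P i) → w ∉ internalSupport (P j)

/-- A rainbow path for an edge coloring: a path whose edges have pairwise distinct colors. -/
def IsRainbowPath {α : Type*} {G : SimpleGraph V} (c : Sym2 V → α)
    {u v : V} (p : G.Walk u v) : Prop :=
  p.IsPath ∧ (p.edges.map c).Nodup

/-- A vertex-rainbow path: a path whose internal vertices have pairwise distinct colors. -/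
def IsVertexRainbowPath {α : Type*} {G : SimpleGraph V} (c : V → α)
    {u v : V} (p : G.Walk u v) : Prop :=
  p.IsPath ∧ ((internalSupport p).map c).Nodup

/-- A total rainbow path: a path whose edges and internal vertices all have
pairwise distinct colors. -/
def IsTotalRainbowPath {α : Type*} {G : SimpleGraph V} (cv : V → α) (ce : Sym2 V → α)
    {u v : V} (p : G.Walk u v) : Prop :=
  p.IsPath ∧ (p.edges.map ce ++ (internalSupport p).map cv).Nodup

/-- `G` is rainbow `k`-connected under the edge coloring `c`: any two distinct vertices are
joined by `k` pairwise internally vertex-disjoint rainbow paths. -/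
def RainbowKConnected {α : Type*} (G : SimpleGraph V) (c : Sym2 V → α) (k : ℕ) : Prop :=
  ∀ u v : V, u ≠ v → ∃ P : Fin k → G.Walk u v,
    (∀ i, IsRainbowPath c (P i)) ∧ InternallyDisjoint P

/-- `G` is rainbow vertex `k`-connected under the vertex coloring `c`. -/
def VertexRainbowKConnected {α : Type*} (G : SimpleGraph V) (c : V → α) (k : ℕ) : Prop :=
  ∀ u v : V, u ≠ v → ∃ P : Fin k → G.Walk u v,
    (∀ i, IsVertexRainbowPath c (P i)) ∧ InternallyDisjoint P

/-- The pair `u, v` is total rainbow `k`-connected under the total coloring `(cv, ce)`: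
`u` and `v` are joined by `k` pairwise internally vertex-disjoint total rainbow paths. -/
def TotalRainbowKConnectedPair {α : Type*} (G : SimpleGraph V)
    (cv : V → α) (ce : Sym2 V → α) (k : ℕ) (u v : V) : Prop :=
  ∃ P : Fin k → G.Walk u v,
    (∀ i, IsTotalRainbowPath cv ce (P i)) ∧ InternallyDisjoint P

/-- `G` is total rainbow `k`-connected under the total coloring `(cv, ce)`. -/
def TotalRainbowKConnected {α : Type*} (G : SimpleGraph V)
    (cv : V → α) (ce : Sym2 V → α) (k : ℕ) : Prop :=
  ∀ u v : V, u ≠ v → TotalRainbowKConnectedPair G cv ce k u v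

/-- The rainbow `k`-connection number: the least number of colors of an edge coloring
making `G` rainbow `k`-connected. -/
noncomputable def rcK (G : SimpleGraph V) (k : ℕ) : ℕ :=
  sInf {t | ∃ c : Sym2 V → Fin t, RainbowKConnected G c k}

/-- The rainbow vertex `k`-connection number. -/
noncomputable def rvcK (G : SimpleGraph V) (k : ℕ) : ℕ :=
  sInf {t | ∃ c : V → Fin t, VertexRainbowKConnected G c k}

/-- The total rainbow `k`-connection number. -/
noncomputable def trcK (G : SimpleGraph V) (k : ℕ) : ℕ :=
  sInf {t | ∃ (cv : V → Fin t) (ce : Sym2 V → Fin t), TotalRainbowKConnected G cv ce k}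

/-- `G` is `l`-connected: it has more than `l` vertices and deleting any set of fewer than
`l` vertices leaves a connected graph. -/
def IsLConnected (G : SimpleGraph V) [Fintype V] (l : ℕ) : Prop :=
  l < Fintype.card V ∧
    ∀ S : Set V, S.ncard < l → (G.induce Sᶜ).Connected

/-- The 2-edge-coloring of the complete graph on `{(i,l) : 1 ≤ i,l ≤ k+1}`: an edge gets
color `0` if its endpoints agree in the first or the second coordinate, color `1` otherwise. -/
noncomputable def gridColor (k : ℕ) : Sym2 (Fin (k + 1) × Fin (k + 1)) → Fin 2 :=
  Sym2.lift ⟨fun a b => if a.1 = b.1 ∨ a.2 = b.2 then 0 else 1,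
    by intro a b; by_cases h : a.1 = b.1 ∨ a.2 = b.2 <;> simp [h, eq_comm]⟩

/-- In a complete graph, a vertex `w ≠ u` which is either `v` itself or is joined to `u` and `v`
by edges of different colors yields a rainbow path from `u` to `v` through `w`. -/
theorem exists_isRainbowPath_top_through {α : Type*} (c : Sym2 V → α) {u v w : V}
    (huv : u ≠ v) (hwu : w ≠ u) (hw : w = v ∨ c s(u, w) ≠ c s(w, v)) :
    ∃ p : (⊤ : SimpleGraph V).Walk u v,
      IsRainbowPath c p ∧ p.snd = w ∧ ∀ x ∈ internalSupport p, x = w := by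
  by_cases hwv : w = v
  · subst hwv
    exact ⟨Walk.cons ((top_adj _ _).2 huv) Walk.nil, by
      simp [IsRainbowPath, huv], by simp, by simp [internalSupport]⟩
  · exact ⟨Walk.cons ((top_adj _ _).2 hwu.symm) (Walk.cons ((top_adj _ _).2 hwv) Walk.nil), by
      simp [IsRainbowPath, huv, hwu.symm, hwv, hw.resolve_left hwv], by simp,
      by simp [internalSupport]⟩

/-- Distinct second vertices as in `exists_isRainbowPath_top_through` yield internally
disjoint rainbow paths. -/
theorem exists_internallyDisjoint_isRainbowPath_top {α : Type*} (c : Sym2 V → α) {u v : V}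
    {k : ℕ} (huv : u ≠ v) (f : Fin k → V) (hf : Function.Injective f) (hfu : ∀ i, f i ≠ u)
    (hfc : ∀ i, f i = v ∨ c s(u, f i) ≠ c s(f i, v)) :
    ∃ P : Fin k → (⊤ : SimpleGraph V).Walk u v,
      (∀ i, IsRainbowPath c (P i)) ∧ InternallyDisjoint P := by
  choose P hP hsnd hint using fun i =>
    exists_isRainbowPath_top_through c huv (hfu i) (hfc i)
  refine ⟨P, hP, fun i j hij => hf ?_, fun i j hij x hi hj => hij (hf ?_)⟩
  · rw [← hsnd i, ← hsnd j, hij]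
  · rw [← hint i x hi, ← hint j x hj]

/-- Let `k ≥ 1` and let `K` be the complete graph on the vertex set
`{(i,l) : 1 ≤ i,l ≤ k+1}`, with the edge joining `(i,l)` and `(j,m)` colored `0` if
`i = j` or `l = m`, and colored `1` otherwise. Under this 2-edge-coloring, any two
distinct vertices are joined by `k` pairwise internally vertex-disjoint rainbow paths. -/
theorem gridColor_rainbowKConnected (k : ℕ) (hk : 1 ≤ k) :
    RainbowKConnected (⊤ : SimpleGraph (Fin (k + 1) × Fin (k + 1))) (gridColor k) k := by
  rintro ⟨a, b⟩ ⟨c, d⟩ huv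
  by_cases hac : a = c
  · subst hac
    have hbd : b ≠ d := fun h => huv (by rw [h])
    refine exists_internallyDisjoint_isRainbowPath_top _ huv (fun i => (a.succAbove i, b))
      (fun i j hij => Fin.succAbove_right_injective (Prod.ext_iff.1 hij).1)
      (fun i h => Fin.succAbove_ne a i (Prod.ext_iff.1 h).1) (fun i => Or.inr ?_)
    simp [gridColor, hbd, Fin.succAbove_ne]
  · refine exists_internallyDisjoint_isRainbowPath_top _ huv
      (fun i => if b.succAbove i = d then (c, d) else (a, b.succAbove i))
      (fun i j hij => Fin.succAbove_right_injective (p := b) ?_) (fun i => ?_) (fun i => ?_)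
    · grind
    · have := Fin.succAbove_ne b i
      grind
    · by_cases h : b.succAbove i = d
      · simp [h]
      · right
        simp [gridColor, h, hac]

end Paper
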